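/- In the n-spin Hamming-weight setting, let H₀ := Σ_i S_i^{s^x}, H₁ := Σ_i S_i^{s^z}, and fix θ ∈ ℝ with sin θ ≠ 1 and sin θ ≠ −1. For each sign pattern ε : Fin n → {+,−}, set Δ := n₊ − n₋ and ζ_ε(θ) := ⟨V_ε(θ), (H₀ + i·H₁)·V_ε(θ)⟩ / ‖V_ε(θ)‖² (well-defined since V_ε(θ) ≠ 0). Then ζ_ε(θ) = (1/2)·((n + Δ·cos θ) + i·(n + Δ·sin θ)); in particular |ζ_ε(θ) − (n/2)(1 + i)| = |Δ|/2, so the critical value curves of the numerical range map are concentric circles centered at the 2^n-fold eigenvalue (n/2)(1 + i) of H₀ + i·H₁. -/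

import Mathlib

open scoped Matrix

/-- `s^x = (1/2)(I − σ^x)` as a complex matrix. -/
noncomputable def sxC : Matrix (Fin 2) (Fin 2) ℂ := !![1/2, -1/2; -1/2, 1/2]

/-- `s^z = (1/2)(I − σ^z)` as a complex matrix. -/
noncomputable def szC : Matrix (Fin 2) (Fin 2) ℂ := !![0, 0; 0, 1]

/-- The operator `S_i^A` acting as `A` on site `i` and as the identity elsewhere. -/
noncomputable def siteOp (n : ℕ) (A : Matrix (Fin 2) (Fin 2) ℂ) (i : Fin n) :
    Matrix (Fin n → Fin 2) (Fin n → Fin 2) ℂ := fun x y =>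
  A (x i) (y i) * ∏ j ∈ Finset.univ.filter (fun j => j ≠ i), (if x j = y j then (1:ℂ) else 0)

/-- The single-spin eigenvector `v_e(θ) = (−e cos θ, 1 + e sin θ)` for a sign `e = ±1`. -/
noncomputable def spinVec (e θ : ℝ) : Fin 2 → ℂ :=
  ![((-(e * Real.cos θ) : ℝ) : ℂ), ((1 + e * Real.sin θ : ℝ) : ℂ)]

/-- The sign `+1` or `−1` attached to a Boolean sign pattern entry. -/
def signVal (b : Bool) : ℝ := if b then 1 else -1

/-- The tensor-product eigenvector `V_ε(θ)(x) = ∏_i (v_{ε(i)}(θ))_{x(i)}`. -/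
noncomputable def bigVec (n : ℕ) (ε : Fin n → Bool) (θ : ℝ) : (Fin n → Fin 2) → ℂ :=
  fun x => ∏ i, spinVec (signVal (ε i)) θ (x i)

/-- The normalized critical value
`ζ_ε(θ) = ⟨V_ε(θ), (H₀ + i H₁) V_ε(θ)⟩ / ‖V_ε(θ)‖²` of the numerical range map. -/
noncomputable def bigCritVal (n : ℕ) (ε : Fin n → Bool) (θ : ℝ) : ℂ :=
  (star (bigVec n ε θ) ⬝ᵥ
      ((∑ i, siteOp n sxC i) + Complex.I • (∑ i, siteOp n szC i)).mulVec (bigVec n ε θ)) /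
    ((∑ x, ‖bigVec n ε θ x‖ ^ 2 : ℝ) : ℂ)

/-- The number of plus signs in the pattern `ε`. -/
def nPlus (n : ℕ) (ε : Fin n → Bool) : ℕ := (Finset.univ.filter (fun i => ε i = true)).card

theorem aux_siteOp_eq (n : ℕ) (A : Matrix (Fin 2) (Fin 2) ℂ) (i : Fin n) (x y : Fin n → Fin 2) :
    siteOp n A i x y =
      ∏ j, (if j = i then A (x j) (y j) else if x j = y j then (1:ℂ) else 0) := by
  unfold siteOp
  rw [← Finset.mul_prod_erase Finset.univ _ (Finset.mem_univ i), if_pos rfl]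
  congr 1
  have : Finset.univ.filter (fun j => j ≠ i) = Finset.univ.erase i := by
    ext j; simp
  rw [this]
  refine Finset.prod_congr rfl fun j hj => ?_
  rw [if_neg (Finset.ne_of_mem_erase hj)]

theorem aux_double (n : ℕ) (f : Fin n → Fin 2 → Fin 2 → ℂ) :
    ∑ x : Fin n → Fin 2, ∑ y : Fin n → Fin 2, ∏ j, f j (x j) (y j) =
      ∏ j, ∑ a, ∑ b, f j a b := by
  rw [Fintype.prod_sum]
  refine Finset.sum_congr rfl fun x _ => ?_
  rw [Fintype.prod_sum]

theorem aux_quad (n : ℕ) (ε : Fin n → Bool) (θ : ℝ) (A : Matrix (Fin 2) (Fin 2) ℂ) (i : Fin n)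
    (r : ℂ)
    (hr : ∑ a, ∑ b, star (spinVec (signVal (ε i)) θ a) * (A a b * spinVec (signVal (ε i)) θ b) =
      ((2 * (1 + signVal (ε i) * Real.sin θ) : ℝ) : ℂ) * r) :
    star (bigVec n ε θ) ⬝ᵥ (siteOp n A i).mulVec (bigVec n ε θ) =
      ((∏ j, (2 * (1 + signVal (ε j) * Real.sin θ)) : ℝ) : ℂ) * r := by
  have e1 : star (bigVec n ε θ) ⬝ᵥ (siteOp n A i).mulVec (bigVec n ε θ) =
      ∑ x : Fin n → Fin 2, ∑ y : Fin n → Fin 2, ∏ j,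
        (star (spinVec (signVal (ε j)) θ (x j)) *
          ((if j = i then A (x j) (y j) else if x j = y j then (1:ℂ) else 0) *
            spinVec (signVal (ε j)) θ (y j))) := by
    simp only [dotProduct, Matrix.mulVec, Finset.mul_sum, aux_siteOp_eq, bigVec, Pi.star_apply,
      Finset.prod_mul_distrib, star_prod]
  rw [e1, aux_double n (fun j a b => star (spinVec (signVal (ε j)) θ a) *
          ((if j = i then A a b else if a = b then (1:ℂ) else 0) *
            spinVec (signVal (ε j)) θ b))]
  have e2 : ∀ j, (∑ a, ∑ b, star (spinVec (signVal (ε j)) θ a) *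
          ((if j = i then A a b else if a = b then (1:ℂ) else 0) *
            spinVec (signVal (ε j)) θ b)) =
      ((2 * (1 + signVal (ε j) * Real.sin θ) : ℝ) : ℂ) * (if j = i then r else 1) := by
    intro j
    by_cases h : j = i
    · subst h
      simpa using hr
    · simp only [if_neg h, mul_one]
      have hs : (signVal (ε j)) ^ 2 = 1 := by unfold signVal; split_ifs <;> norm_num
      have ht := Real.sin_sq_add_cos_sq θ
      have key : (2 * (1 + signVal (ε j) * Real.sin θ) : ℝ) =
        (signVal (ε j) * Real.cos θ) ^ 2 + (1 + signVal (ε j) * Real.sin θ) ^ 2 := by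
        linear_combination (-1 : ℝ) * hs - (signVal (ε j)) ^ 2 * ht
      rw [key]
      simp [Fin.sum_univ_two, spinVec, -Complex.ofReal_cos, -Complex.ofReal_sin, Complex.conj_ofReal]
      ring
  rw [Finset.prod_congr rfl fun j _ => e2 j, Finset.prod_mul_distrib]
  simp

theorem aux_norm (n : ℕ) (ε : Fin n → Bool) (θ : ℝ) :
    (∑ x, ‖bigVec n ε θ x‖ ^ 2 : ℝ) = ∏ j, (2 * (1 + signVal (ε j) * Real.sin θ)) := by
  have e1 : (∑ x, ‖bigVec n ε θ x‖ ^ 2 : ℝ) =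
      ∑ x : Fin n → Fin 2, ∏ j, ‖spinVec (signVal (ε j)) θ (x j)‖ ^ 2 := by
    simp only [bigVec, norm_prod, Finset.prod_pow]
  rw [e1, ← Fintype.prod_sum (fun j a => ‖spinVec (signVal (ε j)) θ a‖ ^ 2)]
  refine Finset.prod_congr rfl fun j _ => ?_
  have hs : (signVal (ε j)) ^ 2 = 1 := by unfold signVal; split_ifs <;> norm_num
  have ht := Real.sin_sq_add_cos_sq θ
  simp only [Fin.sum_univ_two, spinVec, Matrix.cons_val_zero, Matrix.cons_val_one,
    Complex.norm_real, Real.norm_eq_abs, sq_abs]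
  linear_combination hs + (signVal (ε j)) ^ 2 * ht

theorem aux_x (e θ : ℝ) (he : e ^ 2 = 1) :
    ∑ a, ∑ b, star (spinVec e θ a) * (sxC a b * spinVec e θ b) =
      ((2 * (1 + e * Real.sin θ) : ℝ) : ℂ) * (((1 + e * Real.cos θ) / 2 : ℝ) : ℂ) := by
  have ht := Real.sin_sq_add_cos_sq θ
  have key : (2 * (1 + e * Real.sin θ)) * ((1 + e * Real.cos θ) / 2) =
      (1 / 2) * (-(e * Real.cos θ) - (1 + e * Real.sin θ)) ^ 2 := by
    linear_combination (- 1 / 2 : ℝ) * he - e ^ 2 / 2 * ht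
  rw [← Complex.ofReal_mul, key]
  simp [Fin.sum_univ_two, spinVec, sxC, -Complex.ofReal_cos, -Complex.ofReal_sin,
    Complex.conj_ofReal]
  ring

theorem aux_z (e θ : ℝ) :
    ∑ a, ∑ b, star (spinVec e θ a) * (szC a b * spinVec e θ b) =
      ((2 * (1 + e * Real.sin θ) : ℝ) : ℂ) * (((1 + e * Real.sin θ) / 2 : ℝ) : ℂ) := by
  simp [Fin.sum_univ_two, spinVec, szC, -Complex.ofReal_cos, -Complex.ofReal_sin,
    Complex.conj_ofReal]
  ring

theorem aux_sum (n : ℕ) (ε : Fin n → Bool) :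
    ∑ i, signVal (ε i) = (nPlus n ε : ℝ) - ((n - nPlus n ε : ℕ) : ℝ) := by
  have hle : nPlus n ε ≤ n := by
    unfold nPlus
    simpa using Finset.card_filter_le (Finset.univ : Finset (Fin n)) (fun i => ε i = true)
  have h : ∀ i, signVal (ε i) = 2 * (if ε i = true then (1:ℝ) else 0) - 1 := by
    intro i; unfold signVal; split_ifs <;> norm_num
  rw [Nat.cast_sub hle, Finset.sum_congr rfl fun i _ => h i, Finset.sum_sub_distrib,
    ← Finset.mul_sum, Finset.sum_boole]
  simp [nPlus]
  ring

/-- With `Δ = n₊ − n₋`, the critical values along the Hamming-weight adiabatic path are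
`ζ_ε(θ) = (1/2)((n + Δ cos θ) + i(n + Δ sin θ))`; they trace concentric circles of radius
`|Δ|/2` centered at the `2ⁿ`-fold eigenvalue `(n/2)(1 + i)` of `H₀ + i H₁`. -/
theorem hamming_weight_critical_value_circles (n : ℕ) (θ : ℝ) (ε : Fin n → Bool)
    (h1 : Real.sin θ ≠ 1) (h2 : Real.sin θ ≠ -1) :
    bigCritVal n ε θ = (1 / 2 : ℂ) *
        ((((n : ℝ) + ((nPlus n ε : ℝ) - ((n - nPlus n ε : ℕ) : ℝ)) * Real.cos θ : ℝ) : ℂ) +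
          Complex.I *
            (((n : ℝ) + ((nPlus n ε : ℝ) - ((n - nPlus n ε : ℕ) : ℝ)) * Real.sin θ : ℝ) : ℂ)) ∧
    ‖bigCritVal n ε θ - (((n : ℝ) / 2 : ℝ) : ℂ) * (1 + Complex.I)‖
      = |(nPlus n ε : ℝ) - ((n - nPlus n ε : ℕ) : ℝ)| / 2 := by
  set D : ℝ := (nPlus n ε : ℝ) - ((n - nPlus n ε : ℕ) : ℝ) with hD
  have hsum : ∑ i, signVal (ε i) = D := aux_sum n ε
  have hsq : ∀ i, (signVal (ε i)) ^ 2 = 1 := by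
    intro i; unfold signVal; split_ifs <;> norm_num
  have hN : (∏ j, (2 * (1 + signVal (ε j) * Real.sin θ)) : ℝ) ≠ 0 := by
    refine Finset.prod_ne_zero_iff.2 fun j _ => ?_
    refine mul_ne_zero two_ne_zero ?_
    unfold signVal
    split_ifs
    · intro h; exact h2 (by linarith)
    · intro h; exact h1 (by linarith)
  have hlin : ∀ t : ℝ, ∑ i, (1 + signVal (ε i) * t) / 2 = (1 / 2) * ((n : ℝ) + D * t) := by
    intro t
    rw [← Finset.sum_div, Finset.sum_add_distrib, ← Finset.sum_mul, hsum]
    simp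
    ring
  have main : bigCritVal n ε θ = (1 / 2 : ℂ) *
        ((((n : ℝ) + D * Real.cos θ : ℝ) : ℂ) +
          Complex.I * (((n : ℝ) + D * Real.sin θ : ℝ) : ℂ)) := by
    unfold bigCritVal
    rw [aux_norm, div_eq_iff (Complex.ofReal_ne_zero.2 hN), Matrix.add_mulVec, Matrix.smul_mulVec,
      dotProduct_add, dotProduct_smul, Matrix.sum_mulVec, Matrix.sum_mulVec, dotProduct_sum,
      dotProduct_sum,
      Finset.sum_congr rfl fun i _ => aux_quad n ε θ sxC i _ (aux_x _ θ (hsq i)),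
      Finset.sum_congr rfl fun i _ => aux_quad n ε θ szC i _ (aux_z _ θ),
      ← Finset.mul_sum, ← Finset.mul_sum, ← Complex.ofReal_sum, ← Complex.ofReal_sum, hlin, hlin,
      smul_eq_mul, Complex.ofReal_mul (1 / 2), Complex.ofReal_mul (1 / 2)]
    push_cast
    ring
  refine ⟨main, ?_⟩
  have hz : bigCritVal n ε θ - (((n : ℝ) / 2 : ℝ) : ℂ) * (1 + Complex.I) =
      ((D / 2 : ℝ) : ℂ) * Complex.exp (θ * Complex.I) := by
    rw [main, Complex.exp_mul_I]
    push_cast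
    ring
  rw [hz, norm_mul, Complex.norm_exp_ofReal_mul_I, Complex.norm_real, mul_one, Real.norm_eq_abs,
    abs_div, abs_two]
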